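/- Let T1 and T2 be two arbitrary non-trivial finite trees with diam(T1) ≥ diam(T2), and let c be a central vertex of T1 (a vertex of minimum eccentricity). Then for every optimal amalgam A of T1 and T2 (i.e., every amalgam A with h_A(T1^A, T2^A) = H(T1, T2)), the copy c^A of c in A belongs to the vertex set of the intersection T1^A ∩ T2^A. -/

import Mathlib

namespace HDTrees

open SimpleGraph Set

/-- A vertex set `S` is convex in `G`: the induced subgraph is connected and every
shortest path between vertices of `S` stays inside `S`. -/
def ConvexIn {V : Type*} (G : SimpleGraph V) (S : Set V) : Prop :=
  (G.induce S).Connected ∧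
    ∀ u ∈ S, ∀ v ∈ S, ∀ p : G.Walk u v, p.length = G.dist u v →
      ∀ x ∈ p.support, x ∈ S

/-- `A` is an amalgam of `G₁` and `G₂` along the embeddings `f₁`, `f₂`:
the two covers exhaust the vertices and edges of `A`, and the intersection of the
covers corresponds to a convex subgraph on each side. -/
structure IsAmalgam {V₁ V₂ W : Type*} (G₁ : SimpleGraph V₁) (G₂ : SimpleGraph V₂)
    (A : SimpleGraph W) (f₁ : G₁ ↪g A) (f₂ : G₂ ↪g A) : Prop where
  vcover : Set.range ⇑f₁ ∪ Set.range ⇑f₂ = Set.univ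
  ecover : ∀ x y : W, A.Adj x y →
    (x ∈ Set.range ⇑f₁ ∧ y ∈ Set.range ⇑f₁) ∨ (x ∈ Set.range ⇑f₂ ∧ y ∈ Set.range ⇑f₂)
  conv₁ : ConvexIn G₁ (⇑f₁ ⁻¹' Set.range ⇑f₂)
  conv₂ : ConvexIn G₂ (⇑f₂ ⁻¹' Set.range ⇑f₁)

/-- Distance from a vertex to a set of vertices. -/
noncomputable def distToSet {W : Type*} (A : SimpleGraph W) (u : W) (S : Set W) : ℕ :=
  sInf (A.dist u '' S)

/-- The distance between the covers of an amalgam `A` whose intersection has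
vertex set `S`: the maximum over vertices of `A` of the distance to `S`. -/
noncomputable def coverDist {W : Type*} (A : SimpleGraph W) (S : Set W) : ℕ :=
  sSup (Set.range fun u => distToSet A u S)

open scoped Classical in
/-- The Hausdorff distance between two graphs. -/
noncomputable def hausdorffDist {V₁ V₂ : Type*} (G₁ : SimpleGraph V₁)
    (G₂ : SimpleGraph V₂) : ℕ :=
  if Nonempty (G₁ ≃g G₂) then 0
  else sInf {n : ℕ | ∃ (W : Type) (A : SimpleGraph W) (f₁ : G₁ ↪g A) (f₂ : G₂ ↪g A),
    Finite W ∧ IsAmalgam G₁ G₂ A f₁ f₂ ∧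
      coverDist A (Set.range ⇑f₁ ∩ Set.range ⇑f₂) = n}

/-- Eccentricity of a vertex. -/
noncomputable def ecc {V : Type*} (G : SimpleGraph V) (v : V) : ℕ := sSup (Set.range (G.dist v))

/-- Radius of a graph. -/
noncomputable def grad {V : Type*} (G : SimpleGraph V) : ℕ := sInf (Set.range (ecc G))

/-- Diameter of a graph. -/
noncomputable def gdiam {V : Type*} (G : SimpleGraph V) : ℕ := sSup (Set.range (ecc G))

/-- In the tree `T` rooted at `r`, `p` is the parent of `v`. -/
def IsParent {V : Type*} (T : SimpleGraph V) (r p v : V) : Prop :=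
  T.Adj v p ∧ T.dist r p + 1 = T.dist r v

/-- The set of children of `v` in the tree `T` rooted at `r`. -/
def childSet {V : Type*} (T : SimpleGraph V) (r v : V) : Set V := {u | IsParent T r v u}

/-- The vertex set of the subtree rooted at `v` (i.e. `v` and its descendants)
in the tree `T` rooted at `r`. -/
def subtreeSet {V : Type*} (T : SimpleGraph V) (r v : V) : Set V :=
  {u | T.dist r u = T.dist r v + T.dist v u}

lemma mem_subtreeSet_self {V : Type*} (T : SimpleGraph V) (r v : V) :
    v ∈ subtreeSet T r v := by simp [subtreeSet]

/-- The height of the vertex `v` in the tree `T` rooted at `r`. -/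
noncomputable def heightV {V : Type*} (T : SimpleGraph V) (r v : V) : ℕ :=
  sSup (T.dist v '' subtreeSet T r v)

/-- The distance between the covers of an optimal top-down amalgam of the rooted
trees `(T₁, r₁)` and `(T₂, r₂)`: the minimum of the distance between the covers
over all amalgams identifying the two roots. -/
noncomputable def topDownDist {V₁ V₂ : Type*} (T₁ : SimpleGraph V₁) (r₁ : V₁)
    (T₂ : SimpleGraph V₂) (r₂ : V₂) : ℕ :=
  sInf {n : ℕ | ∃ (W : Type) (A : SimpleGraph W) (f₁ : T₁ ↪g A) (f₂ : T₂ ↪g A),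
    Finite W ∧ IsAmalgam T₁ T₂ A f₁ f₂ ∧ f₁ r₁ = f₂ r₂ ∧
      coverDist A (Set.range ⇑f₁ ∩ Set.range ⇑f₂) = n}

/-- `D(x, y)`: the distance between the covers of an optimal top-down amalgam of
the subtree of `(T₁, r₁)` rooted at `x` and the subtree of `(T₂, r₂)` rooted at `y`. -/
noncomputable def subtreeDist {V₁ V₂ : Type*} (T₁ : SimpleGraph V₁) (r₁ : V₁)
    (T₂ : SimpleGraph V₂) (r₂ : V₂) (x : V₁) (y : V₂) : ℕ :=
  topDownDist (T₁.induce (subtreeSet T₁ r₁ x)) ⟨x, mem_subtreeSet_self T₁ r₁ x⟩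
    (T₂.induce (subtreeSet T₂ r₂ y)) ⟨y, mem_subtreeSet_self T₂ r₂ y⟩

/-- `S` is (the vertex set of) a top-down subtree of the tree `T` rooted at `r`. -/
def IsTopDown {V : Type*} (T : SimpleGraph V) (r : V) (S : Set V) : Prop :=
  r ∈ S ∧ ∀ v ∈ S, v ≠ r → ∀ p : V, IsParent T r p v → p ∈ S

/-- `M` is a rooted tree isomorphism (as a set of pairs) between subsets of the rooted
trees `(T₁, r₁)` and `(T₂, r₂)`: it is functional and injective in both coordinates,
matches the roots and maps parents to parents. -/
def IsRootedIso {V₁ V₂ : Type*} (T₁ : SimpleGraph V₁) (r₁ : V₁)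
    (T₂ : SimpleGraph V₂) (r₂ : V₂) (M : Set (V₁ × V₂)) : Prop :=
  (r₁, r₂) ∈ M ∧
  (∀ v w w', (v, w) ∈ M → (v, w') ∈ M → w = w') ∧
  (∀ v v' w, (v, w) ∈ M → (v', w) ∈ M → v = v') ∧
  (∀ v w, (v, w) ∈ M → (v = r₁ ↔ w = r₂)) ∧
  (∀ v w, (v, w) ∈ M → ∀ pv, IsParent T₁ r₁ pv v → ∀ pw, IsParent T₂ r₂ pw w →
    (pv, pw) ∈ M)

/-- The inductive description of the reconstructed mapping `M ⊆ M'`: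
`(r₁, r₂) ∈ M`, and a pair of non-root vertices lies in `M` iff it lies in `M'`
and the pair of parents lies in `M`. -/
def ReconFix {V₁ V₂ : Type*} (T₁ : SimpleGraph V₁) (r₁ : V₁)
    (T₂ : SimpleGraph V₂) (r₂ : V₂) (M' M : Set (V₁ × V₂)) : Prop :=
  ∀ v w, (v, w) ∈ M ↔ ((v, w) ∈ M' ∧
    ((v = r₁ ∧ w = r₂) ∨ (v ≠ r₁ ∧ w ≠ r₂ ∧
      ∃ pv pw, IsParent T₁ r₁ pv v ∧ IsParent T₂ r₂ pw w ∧ (pv, pw) ∈ M)))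

lemma dist_le_ecc {V : Type*} [Finite V] (G : SimpleGraph V) (u v : V) :
    G.dist u v ≤ ecc G u :=
  le_csSup (Set.finite_range _).bddAbove ⟨v, rfl⟩

lemma ecc_le_gdiam {V : Type*} [Finite V] (G : SimpleGraph V) (v : V) :
    ecc G v ≤ gdiam G :=
  le_csSup (Set.finite_range _).bddAbove ⟨v, rfl⟩

lemma exists_dist_eq_ecc {V : Type*} [Finite V] (G : SimpleGraph V) (u : V) :
    ∃ v, G.dist u v = ecc G u :=
  (Set.range_nonempty_iff_nonempty.2 ⟨u⟩).csSup_mem (Set.finite_range (G.dist u))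

lemma exists_dist_eq_gdiam {V : Type*} [Finite V] [Nonempty V] (G : SimpleGraph V) :
    ∃ u v, G.dist u v = gdiam G := by
  obtain ⟨u, hu⟩ := (Set.range_nonempty (ecc G)).csSup_mem (Set.finite_range _)
  obtain ⟨v, hv⟩ := exists_dist_eq_ecc G u
  exact ⟨u, v, hv.trans hu⟩

lemma grad_le_ecc {V : Type*} (G : SimpleGraph V) (v : V) : grad G ≤ ecc G v :=
  Nat.sInf_le ⟨v, rfl⟩

lemma exists_ecc_eq_grad {V : Type*} [Nonempty V] (G : SimpleGraph V) :
    ∃ c, ecc G c = grad G :=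
  Nat.sInf_mem (Set.range_nonempty (ecc G))

lemma dist_add_dist_of_mem_support {V : Type*} {G : SimpleGraph V} {u v z : V}
    (p : G.Walk u v) (hp : p.length = G.dist u v) (hz : z ∈ p.support) :
    G.dist u z + G.dist z v ≤ G.dist u v := by
  classical
  have h := congrArg Walk.length (p.take_spec hz)
  rw [Walk.length_append] at h
  have h₁ := dist_le (p.takeUntil z hz)
  have h₂ := dist_le (p.dropUntil z hz)
  omega

lemma mem_of_dist_add_dist_eq {V : Type*} {G : SimpleGraph V} (hG : G.Connected) {S : Set V}
    (hS : ConvexIn G S) {u v z : V} (hu : u ∈ S) (hv : v ∈ S)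
    (hz : G.dist u z + G.dist z v = G.dist u v) : z ∈ S := by
  obtain ⟨p, hp⟩ := hG.exists_walk_length_eq_dist u z
  obtain ⟨q, hq⟩ := hG.exists_walk_length_eq_dist z v
  refine hS.2 u hu v hv (p.append q) (by rw [Walk.length_append]; omega) z ?_
  rw [Walk.mem_support_append_iff]
  exact Or.inl p.end_mem_support

/-- A geodesic between vertices on different sides of an edge of a tree crosses that edge. -/
lemma dist_eq_of_opposite_sides {V : Type*} {T : SimpleGraph V} (hT : T.IsTree) {b c x y : V}
    (hcb : T.Adj c b) (hy : T.dist b y = T.dist c y + 1) (hx : T.dist c x = T.dist b x + 1) :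
    T.dist y x = T.dist c y + T.dist b x + 1 := by
  have hconn := hT.connected
  obtain ⟨p, hp⟩ := hconn.exists_walk_length_eq_dist y c
  obtain ⟨q, hq⟩ := hconn.exists_walk_length_eq_dist b x
  have hpath : (p.append (Walk.cons hcb q)).IsPath := by
    rw [Walk.isPath_def, Walk.support_append, List.nodup_append']
    refine ⟨(p.isPath_of_length_eq_dist hp).support_nodup, ?_, ?_⟩
    · simpa using (q.isPath_of_length_eq_dist hq).support_nodup
    · intro z hzp hzq
      simp only [Walk.support_cons, List.tail_cons] at hzq
      have h₁ := dist_add_dist_of_mem_support p hp hzp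
      have h₂ := dist_add_dist_of_mem_support q hq hzq
      have h₃ := hconn.dist_triangle (u := b) (v := z) (w := y)
      have h₄ := hconn.dist_triangle (u := c) (v := z) (w := x)
      rw [dist_comm (u := y) (v := z), dist_comm (u := y) (v := c),
        dist_comm (u := z) (v := c)] at h₁
      omega
  obtain ⟨r, hr, hlen⟩ := hconn.exists_path_of_dist y x
  rw [← hlen, (hT.existsUnique_path y x).unique hr hpath, Walk.length_append, Walk.length_cons,
    hp, hq, dist_comm (u := y)]
  omega

lemma dist_adj_cases {V : Type*} {T : SimpleGraph V} (hT : T.IsTree) {b c : V}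
    (hcb : T.Adj c b) (x : V) :
    T.dist b x = T.dist c x + 1 ∨ T.dist c x = T.dist b x + 1 := by
  have h := hT.dist_eq_dist_add_one_of_adj x hcb
  rw [dist_comm (u := x), dist_comm (u := x)] at h
  omega

lemma exists_adj_dist_eq {V : Type*} {G : SimpleGraph V} (hG : G.Connected) {u v : V}
    (h : u ≠ v) : ∃ w, G.Adj u w ∧ G.dist u v = G.dist w v + 1 := by
  obtain ⟨p, hp⟩ := hG.exists_walk_length_eq_dist u v
  cases p with
  | nil => exact absurd rfl h
  | @cons _ w _ hadj q =>
    refine ⟨w, hadj, ?_⟩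
    have h₁ := dist_le q
    have h₂ := hG.dist_triangle (u := u) (v := w) (w := v)
    rw [dist_eq_one_iff_adj.2 hadj] at h₂
    rw [Walk.length_cons] at hp
    omega

/-- Every vertex of a tree is within half the diameter of a suitable central edge. -/
lemma exists_central_edge {V : Type*} [Fintype V] {T : SimpleGraph V} (hT : T.IsTree)
    (hn : 1 < Fintype.card V) :
    ∃ a b, T.Adj a b ∧ ∀ x, 2 * T.dist a x ≤ gdiam T ∨ 2 * T.dist b x ≤ gdiam T := by
  have hconn := hT.connected
  have : Nontrivial V := Fintype.one_lt_card_iff_nontrivial.1 hn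
  obtain ⟨c, hc⟩ := exists_ecc_eq_grad T
  obtain ⟨x, hx⟩ := exists_dist_eq_ecc T c
  have hcx : c ≠ x := by
    rintro rfl
    obtain ⟨y, hy⟩ := exists_ne c
    have h₁ := hconn.pos_dist_of_ne hy.symm
    have h₂ := dist_le_ecc T c y
    rw [← hx, dist_self] at h₂
    omega
  obtain ⟨b, hcb, hb⟩ := exists_adj_dist_eq hconn hcx
  obtain ⟨z, hz⟩ := exists_dist_eq_ecc T b
  have hbr := grad_le_ecc T b
  have diam_ge (u v) : T.dist u v ≤ gdiam T := (dist_le_ecc T u v).trans (ecc_le_gdiam T u)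
  refine ⟨c, b, hcb, fun y => ?_⟩
  have hcz := dist_le_ecc T c z
  have hcy := dist_le_ecc T c y
  have hdz := diam_ge z x
  have hdy := diam_ge y x
  obtain ⟨u, v, huv⟩ := exists_dist_eq_gdiam T
  have huc := dist_le_ecc T c u
  have hvc := dist_le_ecc T c v
  have htri := hconn.dist_triangle (u := u) (v := c) (w := v)
  rw [dist_comm (u := u) (v := c)] at htri
  rcases dist_adj_cases hT hcb z with h | h
  · rw [dist_eq_of_opposite_sides hT hcb h hb] at hdz
    rcases dist_adj_cases hT hcb y with h' | h'
    · rw [dist_eq_of_opposite_sides hT hcb h' hb] at hdy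
      omega
    · omega
  · omega

/-- A central vertex of a tree has a far vertex on its own side of each incident edge. -/
lemma exists_far_of_central {V : Type*} [Finite V] {T : SimpleGraph V} (hT : T.IsTree) {c b : V}
    (hc : ecc T c = grad T) (hcb : T.Adj c b) :
    ∃ x, T.dist b x = T.dist c x + 1 ∧ gdiam T ≤ 2 * T.dist c x + 1 := by
  have hconn := hT.connected
  have : Nonempty V := ⟨c⟩
  obtain ⟨u, v, huv⟩ := exists_dist_eq_gdiam T
  have huc := dist_le_ecc T c u
  have hvc := dist_le_ecc T c v
  have hbr := grad_le_ecc T b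
  obtain ⟨z, hz⟩ := exists_dist_eq_ecc T b
  have hcz := dist_le_ecc T c z
  have htri := hconn.dist_triangle (u := u) (v := c) (w := v)
  have htri' := hconn.dist_triangle (u := u) (v := b) (w := v)
  rw [dist_comm (u := u) (v := c)] at htri
  rw [dist_comm (u := u) (v := b)] at htri'
  by_contra! hcon
  have h₁ := hcon u
  have h₂ := hcon v
  have h₃ := hcon z
  rcases dist_adj_cases hT hcb u with hu | hu <;>
  rcases dist_adj_cases hT hcb v with hv | hv <;>
  rcases dist_adj_cases hT hcb z with hz' | hz' <;> omega

/-- A convex set avoiding a vertex `c` of a tree lies beyond one of the edges at `c`. -/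
lemma exists_edge_separating {V : Type*} {T : SimpleGraph V} (hT : T.IsTree) {S : Set V}
    (hS : ConvexIn T S) {c : V} (hc : c ∉ S) :
    ∃ b, T.Adj c b ∧ ∀ s ∈ S, T.dist c s = T.dist b s + 1 := by
  obtain ⟨s, hs⟩ := hS.1.nonempty
  obtain ⟨b, hcb, hb⟩ := exists_adj_dist_eq hT.connected (ne_of_mem_of_not_mem hs hc).symm
  refine ⟨b, hcb, fun t ht => (dist_adj_cases hT hcb t).resolve_left fun h => hc ?_⟩
  refine mem_of_dist_add_dist_eq hT.connected hS ht hs ?_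
  rw [dist_eq_of_opposite_sides hT hcb h hb, hb, dist_comm (u := t)]
  omega

/-- Walking from the first cover to the intersection is not shorter in the amalgam. -/
lemma exists_dist_le_walk_length {V₁ V₂ W : Type*} {G₁ : SimpleGraph V₁} {G₂ : SimpleGraph V₂}
    {A : SimpleGraph W} {f₁ : G₁ ↪g A} {f₂ : G₂ ↪g A} (hA : IsAmalgam G₁ G₂ A f₁ f₂)
    (hG : G₁.Connected) {w w' : W} (p : A.Walk w w') :
    w' ∈ Set.range ⇑f₁ ∩ Set.range ⇑f₂ → ∀ u, f₁ u = w →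
      ∃ s ∈ ⇑f₁ ⁻¹' Set.range ⇑f₂, G₁.dist u s ≤ p.length := by
  induction p with
  | nil =>
    rintro hw u rfl
    exact ⟨u, hw.2, by simp⟩
  | cons hadj q ih =>
    rintro hw u rfl
    by_cases hu : f₁ u ∈ Set.range ⇑f₂
    · exact ⟨u, hu, by simp⟩
    obtain ⟨-, v, rfl⟩ := (hA.ecover _ _ hadj).resolve_right fun h => hu h.1
    obtain ⟨s, hs, hle⟩ := ih hw v rfl
    refine ⟨s, hs, ?_⟩
    have htri := hG.dist_triangle (u := u) (v := v) (w := s)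
    rw [dist_eq_one_iff_adj.2 (f₁.map_adj_iff.1 hadj)] at htri
    rw [Walk.length_cons]
    omega

lemma exists_dist_le_coverDist {V₁ V₂ W : Type*} [Finite W] {G₁ : SimpleGraph V₁}
    {G₂ : SimpleGraph V₂} {A : SimpleGraph W} {f₁ : G₁ ↪g A} {f₂ : G₂ ↪g A}
    (hA : IsAmalgam G₁ G₂ A f₁ f₂) (hG : G₁.Connected) (u : V₁) :
    ∃ s ∈ ⇑f₁ ⁻¹' Set.range ⇑f₂,
      G₁.dist u s ≤ coverDist A (Set.range ⇑f₁ ∩ Set.range ⇑f₂) := by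
  obtain ⟨s₀, hs₀⟩ := hA.conv₁.1.nonempty
  obtain ⟨_, ⟨⟨s, rfl⟩, hs⟩, hdist⟩ : distToSet A (f₁ u) (Set.range ⇑f₁ ∩ Set.range ⇑f₂) ∈
      A.dist (f₁ u) '' (Set.range ⇑f₁ ∩ Set.range ⇑f₂) :=
    Nat.sInf_mem (Set.Nonempty.image _ ⟨f₁ s₀, ⟨s₀, rfl⟩, hs₀⟩)
  obtain ⟨p, hp⟩ := ((hG u s).map f₁.toHom).exists_walk_length_eq_dist
  obtain ⟨t, ht, hle⟩ := exists_dist_le_walk_length hA hG p ⟨⟨s, rfl⟩, hs⟩ u rfl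
  refine ⟨t, ht, hle.trans ?_⟩
  rw [hp]
  exact hdist.le.trans (le_csSup (Set.finite_range _).bddAbove ⟨f₁ u, rfl⟩)

lemma convexIn_pair {V : Type*} {G : SimpleGraph V} {a b : V} (hab : G.Adj a b) :
    ConvexIn G {a, b} := by
  refine ⟨induce_pair_connected_of_adj hab, fun u hu v hv p hp x hx => ?_⟩
  have hle : G.dist u v ≤ 1 := by
    rcases hu with rfl | rfl <;> rcases hv with rfl | rfl <;>
      simp [dist_eq_one_iff_adj.2 hab, dist_eq_one_iff_adj.2 hab.symm]
  match p, hp, hx with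
  | .nil, _, hx => rwa [Walk.mem_support_nil_iff.1 hx]
  | .cons _ .nil, _, hx =>
    simp only [Walk.support_cons, Walk.support_nil, List.mem_cons, List.not_mem_nil,
      or_false] at hx
    rcases hx with rfl | rfl <;> assumption
  | .cons _ (.cons _ q), hp, _ =>
    simp only [Walk.length_cons] at hp
    omega

lemma dist_map_le {V W : Type*} {G : SimpleGraph V} {A : SimpleGraph W} (hG : G.Connected)
    (f : G ↪g A) (u v : V) : A.dist (f u) (f v) ≤ G.dist u v := by
  obtain ⟨p, hp⟩ := hG.exists_walk_length_eq_dist u v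
  rw [← hp, ← Walk.length_map f.toHom p]
  exact dist_le _

/-- Two finite types can be glued along a pair of points of each. -/
lemma exists_glue_pair {V₁ V₂ : Type*} [Finite V₁] [Finite V₂] {a₁ b₁ : V₁} {a₂ b₂ : V₂}
    (h₁ : a₁ ≠ b₁) (h₂ : a₂ ≠ b₂) :
    ∃ (W : Type) (f₁ : V₁ ↪ W) (f₂ : V₂ ↪ W), Finite W ∧
      Set.range f₁ ∪ Set.range f₂ = Set.univ ∧
      ∀ x y, f₁ x = f₂ y ↔ (x = a₁ ∧ y = a₂) ∨ (x = b₁ ∧ y = b₂) := by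
  classical
  obtain ⟨n, ⟨e⟩⟩ := Finite.exists_equiv_fin (V₁ ⊕ {y : V₂ // y ≠ a₂ ∧ y ≠ b₂})
  let g : V₂ → V₁ ⊕ {y : V₂ // y ≠ a₂ ∧ y ≠ b₂} := fun y =>
    if ha : y = a₂ then .inl a₁ else if hb : y = b₂ then .inl b₁ else .inr ⟨y, ha, hb⟩
  have hg : Function.Injective g := by
    intro y y' h
    simp only [g] at h
    split_ifs at h <;> simp_all
  refine ⟨Fin n, Function.Embedding.inl.trans e.toEmbedding,
    (⟨g, hg⟩ : V₂ ↪ _).trans e.toEmbedding, inferInstance, ?_, fun x y => ?_⟩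
  · refine Set.eq_univ_of_forall fun w => ?_
    obtain ⟨w | ⟨y, ha, hb⟩, rfl⟩ := e.surjective w
    · exact Or.inl ⟨w, rfl⟩
    · exact Or.inr ⟨y, by simp [g, ha, hb]⟩
  · simp only [Function.Embedding.trans_apply, e.apply_eq_iff_eq,
      Function.Embedding.inl_apply, Function.Embedding.coeFn_mk, g]
    split_ifs <;> simp_all

/-- Gluing two graphs along an edge of each gives an amalgam. -/
lemma exists_amalgam_along_edge {V₁ V₂ : Type*} [Finite V₁] [Finite V₂] {G₁ : SimpleGraph V₁}
    {G₂ : SimpleGraph V₂} {a₁ b₁ : V₁} {a₂ b₂ : V₂} (h₁ : G₁.Adj a₁ b₁) (h₂ : G₂.Adj a₂ b₂) :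
    ∃ (W : Type) (A : SimpleGraph W) (f₁ : G₁ ↪g A) (f₂ : G₂ ↪g A),
      Finite W ∧ IsAmalgam G₁ G₂ A f₁ f₂ ∧ f₁ a₁ = f₂ a₂ ∧ f₁ b₁ = f₂ b₂ := by
  obtain ⟨W, f₁, f₂, hW, hcover, heq⟩ := exists_glue_pair h₁.ne h₂.ne
  have hadj (x y : W) : (G₁.map f₁ ⊔ G₂.map f₂).Adj x y ↔
      (∃ u v, G₁.Adj u v ∧ f₁ u = x ∧ f₁ v = y) ∨ (∃ u v, G₂.Adj u v ∧ f₂ u = x ∧ f₂ v = y) := by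
    rw [sup_adj, map_adj, map_adj]
  let F₁ : G₁ ↪g G₁.map f₁ ⊔ G₂.map f₂ := ⟨f₁, by
    intro u v
    rw [hadj]
    refine ⟨?_, fun h => Or.inl ⟨u, v, h, rfl, rfl⟩⟩
    rintro (⟨u', v', h, hu, hv⟩ | ⟨u', v', h, hu, hv⟩)
    · rwa [← f₁.injective hu, ← f₁.injective hv]
    · have hne := h.ne
      rcases (heq u u').1 hu.symm with ⟨rfl, rfl⟩ | ⟨rfl, rfl⟩ <;>
      rcases (heq v v').1 hv.symm with ⟨rfl, rfl⟩ | ⟨rfl, rfl⟩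
      exacts [absurd rfl hne, h₁, h₁.symm, absurd rfl hne]⟩
  let F₂ : G₂ ↪g G₁.map f₁ ⊔ G₂.map f₂ := ⟨f₂, by
    intro u v
    rw [hadj]
    refine ⟨?_, fun h => Or.inr ⟨u, v, h, rfl, rfl⟩⟩
    rintro (⟨u', v', h, hu, hv⟩ | ⟨u', v', h, hu, hv⟩)
    · have hne := h.ne
      rcases (heq u' u).1 hu with ⟨rfl, rfl⟩ | ⟨rfl, rfl⟩ <;>
      rcases (heq v' v).1 hv with ⟨rfl, rfl⟩ | ⟨rfl, rfl⟩
      exacts [absurd rfl hne, h₂, h₂.symm, absurd rfl hne]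
    · rwa [← f₂.injective hu, ← f₂.injective hv]⟩
  have hpre₁ : ⇑F₁ ⁻¹' Set.range ⇑F₂ = {a₁, b₁} := by
    ext x
    constructor
    · rintro ⟨y, hy⟩
      exact ((heq x y).1 hy.symm).imp And.left And.left
    · rintro (rfl | rfl)
      exacts [⟨a₂, ((heq _ _).2 (Or.inl ⟨rfl, rfl⟩)).symm⟩,
        ⟨b₂, ((heq _ _).2 (Or.inr ⟨rfl, rfl⟩)).symm⟩]
  have hpre₂ : ⇑F₂ ⁻¹' Set.range ⇑F₁ = {a₂, b₂} := by
    ext y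
    constructor
    · rintro ⟨x, hx⟩
      exact ((heq x y).1 hx).imp And.right And.right
    · rintro (rfl | rfl)
      exacts [⟨a₁, (heq _ _).2 (Or.inl ⟨rfl, rfl⟩)⟩, ⟨b₁, (heq _ _).2 (Or.inr ⟨rfl, rfl⟩)⟩]
  refine ⟨W, _, F₁, F₂, hW, ⟨hcover, ?_, ?_, ?_⟩, (heq _ _).2 (Or.inl ⟨rfl, rfl⟩),
    (heq _ _).2 (Or.inr ⟨rfl, rfl⟩)⟩
  · intro x y h
    rcases (hadj x y).1 h with ⟨u, v, -, rfl, rfl⟩ | ⟨u, v, -, rfl, rfl⟩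
    exacts [Or.inl ⟨⟨u, rfl⟩, ⟨v, rfl⟩⟩, Or.inr ⟨⟨u, rfl⟩, ⟨v, rfl⟩⟩]
  · rw [hpre₁]
    exact convexIn_pair h₁
  · rw [hpre₂]
    exact convexIn_pair h₂

lemma distToSet_map_le {V W : Type*} {G : SimpleGraph V} {A : SimpleGraph W} (hG : G.Connected)
    (f : G ↪g A) {S : Set W} {s : V} (hs : f s ∈ S) (u : V) :
    distToSet A (f u) S ≤ G.dist s u := by
  rw [dist_comm]
  have h : distToSet A (f u) S ≤ A.dist (f u) (f s) := Nat.sInf_le ⟨f s, hs, rfl⟩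
  exact h.trans (dist_map_le hG f u s)

/-- Gluing along central edges bounds the Hausdorff distance by half the diameter. -/
lemma two_mul_hausdorffDist_le {V₁ V₂ : Type*} [Fintype V₁] [Fintype V₂]
    {T₁ : SimpleGraph V₁} {T₂ : SimpleGraph V₂} (h₁ : T₁.IsTree) (h₂ : T₂.IsTree)
    (hn₁ : 1 < Fintype.card V₁) (hn₂ : 1 < Fintype.card V₂) (hdiam : gdiam T₂ ≤ gdiam T₁) :
    2 * hausdorffDist T₁ T₂ ≤ gdiam T₁ := by
  unfold hausdorffDist
  split_ifs
  · simp
  obtain ⟨a₁, b₁, hab₁, hd₁⟩ := exists_central_edge h₁ hn₁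
  obtain ⟨a₂, b₂, hab₂, hd₂⟩ := exists_central_edge h₂ hn₂
  obtain ⟨W, A, f₁, f₂, hW, hA, ha, hb⟩ := exists_amalgam_along_edge hab₁ hab₂
  suffices h : coverDist A (Set.range ⇑f₁ ∩ Set.range ⇑f₂) ≤ gdiam T₁ / 2 by
    refine (Nat.mul_le_mul_left 2 ((Nat.sInf_le ?_).trans h)).trans (Nat.mul_div_le _ _)
    exact ⟨W, A, f₁, f₂, hW, hA, rfl⟩
  have haS : f₁ a₁ ∈ Set.range ⇑f₁ ∩ Set.range ⇑f₂ := ⟨⟨a₁, rfl⟩, ⟨a₂, ha.symm⟩⟩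
  have hbS : f₁ b₁ ∈ Set.range ⇑f₁ ∩ Set.range ⇑f₂ := ⟨⟨b₁, rfl⟩, ⟨b₂, hb.symm⟩⟩
  have : Nonempty W := ⟨f₁ a₁⟩
  refine csSup_le (Set.range_nonempty _) ?_
  rintro _ ⟨w, rfl⟩
  have hw : w ∈ Set.range ⇑f₁ ∪ Set.range ⇑f₂ := hA.vcover ▸ Set.mem_univ w
  rcases hw with ⟨u, rfl⟩ | ⟨u, rfl⟩
  · have hua := distToSet_map_le h₁.connected f₁ haS u
    have hub := distToSet_map_le h₁.connected f₁ hbS u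
    have := hd₁ u
    dsimp only
    omega
  · have hua := distToSet_map_le h₂.connected f₂ (ha ▸ haS) u
    have hub := distToSet_map_le h₂.connected f₂ (hb ▸ hbS) u
    have := hd₂ u
    dsimp only
    omega

/-- for non-trivial trees with `diam T₁ ≥ diam T₂`, every central vertex of
`T₁` lies in the intersection of every optimal amalgam. -/
theorem central_vertex_mem_optimal_amalgam {V₁ V₂ : Type*} [Fintype V₁] [Fintype V₂]
    (T₁ : SimpleGraph V₁) (T₂ : SimpleGraph V₂)
    (h₁ : T₁.IsTree) (h₂ : T₂.IsTree)
    (hn₁ : 1 < Fintype.card V₁) (hn₂ : 1 < Fintype.card V₂)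
    (hdiam : gdiam T₂ ≤ gdiam T₁)
    (c : V₁) (hc : ecc T₁ c = grad T₁) :
    ∀ (W : Type) (A : SimpleGraph W) (f₁ : T₁ ↪g A) (f₂ : T₂ ↪g A),
      Finite W → IsAmalgam T₁ T₂ A f₁ f₂ →
      coverDist A (Set.range ⇑f₁ ∩ Set.range ⇑f₂) = hausdorffDist T₁ T₂ →
      f₁ c ∈ Set.range ⇑f₁ ∩ Set.range ⇑f₂ := by
  intro W A f₁ f₂ hW hA hopt
  by_contra hmem
  have hcS : c ∉ ⇑f₁ ⁻¹' Set.range ⇑f₂ := fun h => hmem ⟨⟨c, rfl⟩, h⟩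
  obtain ⟨b, hcb, hb⟩ := exists_edge_separating h₁ hA.conv₁ hcS
  obtain ⟨x, hx, hfar⟩ := exists_far_of_central h₁ hc hcb
  obtain ⟨s, hs, hle⟩ := exists_dist_le_coverDist hA h₁.connected x
  rw [dist_eq_of_opposite_sides h₁ hcb hx (hb s hs), hopt] at hle
  have := two_mul_hausdorffDist_le h₁ h₂ hn₁ hn₂ hdiam
  omega
end HDTrees
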